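/- Let X and Y be disjoint node sets in an MPDAG G = (V,E) and suppose there is no proper possibly causal path from X to Y in G that starts with an undirected edge. Let (B_1,…,B_k), k ≥ 1, be the bucket decomposition of An(Y, G_{V∖X}) ordered as a partial causal ordering in G. For i ∈ {1,…,k}, let X_{p_i} = X ∩ Pa(B_i,G) and X_{n_i} = X ∖ Pa(B_i,G), and for a DAG D in [G] let X'_{n_i} = X_{n_i} ∖ An(P_i, D_{X̄_{p_i}}) where P_i = (∪_{j=1}^{i-1} B_j) ∩ Pa(B_i,G) (P_1 = ∅). Then for every DAG D in [G], B_i is d-separated from X_{n_i} given Pa(B_i,G) = X_{p_i} ∪ P_i in the graph obtained from D by removing all edges into X_{p_i} ∪ X'_{n_i}. -/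

import Mathlib

open scoped Classical

noncomputable section

/-- A partially directed graph on node type `V`: directed (`dir`) and undirected (`undir`)
edges, with at most one edge between any two nodes. -/
structure PDG (V : Type) where
  dir : V → V → Prop
  undir : V → V → Prop
  undir_symm : ∀ a b, undir a b → undir b a
  dir_irrefl : ∀ a, ¬ dir a a
  undir_irrefl : ∀ a, ¬ undir a a
  dir_asymm : ∀ a b, dir a b → ¬ dir b a
  dir_not_undir : ∀ a b, dir a b → ¬ undir a b

namespace PDG

variable {V : Type}

/-- Two nodes are adjacent if there is an edge between them. -/
def Adj (G : PDG V) (a b : V) : Prop := G.dir a b ∨ G.dir b a ∨ G.undir a b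

/-- No directed cycles. -/
def Acyclic (G : PDG V) : Prop := ∀ a, ¬ Relation.TransGen G.dir a a

/-- A maximally oriented PDAG (MPDAG): a partially directed graph with no directed
cycles, in which none of the four configurations of Meek's orientation rules occurs
as an induced subgraph. -/
structure IsMPDAG (G : PDG V) : Prop where
  acyclic : G.Acyclic
  meek1 : ∀ a b c, G.dir a b → G.undir b c → G.Adj a c
  meek2 : ∀ a b c, G.dir a b → G.dir b c → ¬ G.undir a c
  meek3 : ∀ i j k l, k ≠ l → G.undir i j → G.undir i k → G.undir i l →
      G.dir k j → G.dir l j → G.Adj k l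
  meek4 : ∀ i j k l, G.undir i j → G.undir i k → G.undir i l →
      G.dir j l → G.dir l k → G.Adj j k

/-- A DAG: only directed edges, no directed cycles. -/
def IsDAG (G : PDG V) : Prop := (∀ a b, ¬ G.undir a b) ∧ G.Acyclic

/-- `⟨a,b,c⟩` is an unshielded collider. -/
def UnshieldedCollider (G : PDG V) (a b c : V) : Prop :=
  a ≠ c ∧ G.dir a b ∧ G.dir c b ∧ ¬ G.Adj a c

/-- `D ∈ [G]` : `D` is a DAG represented by the MPDAG `G`: same adjacencies,
same unshielded colliders, containing every directed edge of `G`. -/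
def InClassOf (D G : PDG V) : Prop :=
  IsDAG D ∧ (∀ a b, G.Adj a b ↔ D.Adj a b) ∧
    (∀ a b c, G.UnshieldedCollider a b c ↔ D.UnshieldedCollider a b c) ∧
    (∀ a b, G.dir a b → D.dir a b)

/-- `p` is a path: a sequence of at least two distinct nodes in which every pair of
successive nodes is adjacent. -/
def IsPath (G : PDG V) (p : List V) : Prop :=
  2 ≤ p.length ∧ p.Nodup ∧ p.Chain' G.Adj

/-- `p` is a path from `a` to `b`. -/
def IsPathFrom (G : PDG V) (p : List V) (a b : V) : Prop :=
  G.IsPath p ∧ p.head? = some a ∧ p.getLast? = some b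

/-- `p` is a possibly causal path: no edge `V_i ← V_j` with `i < j` is in `G`. -/
def PossiblyCausal (G : PDG V) (p : List V) : Prop :=
  G.IsPath p ∧ ∀ i j : Fin p.length, (i : ℕ) < (j : ℕ) → ¬ G.dir (p.get j) (p.get i)

/-- `p` is a causal path: all edges directed towards the endpoint. -/
def IsCausal (G : PDG V) (p : List V) : Prop :=
  2 ≤ p.length ∧ p.Nodup ∧ p.Chain' G.dir

/-- `p` is an undirected path. -/
def IsUndirPath (G : PDG V) (p : List V) : Prop :=
  p ≠ [] ∧ p.Nodup ∧ p.Chain' G.undir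

/-- `p` is unshielded: every two nodes at distance two on `p` are nonadjacent. -/
def Unshielded (G : PDG V) (p : List V) : Prop :=
  ∀ (i : ℕ) (h : i + 2 < p.length),
    ¬ G.Adj (p.get ⟨i, by omega⟩) (p.get ⟨i + 2, h⟩)

/-- `p` is proper w.r.t. the node set `X` : only its first node is in `X`. -/
def ProperFrom (X : Finset V) (p : List V) : Prop :=
  (∃ a ∈ X, p.head? = some a) ∧ ∀ i : Fin p.length, 0 < (i : ℕ) → p.get i ∉ X

/-- the last node of `p` is in `Y`. -/
def EndsIn (Y : Finset V) (p : List V) : Prop := ∃ b ∈ Y, p.getLast? = some b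

/-- `p` starts with an undirected edge. -/
def StartsUndirected (G : PDG V) (p : List V) : Prop :=
  ∃ a b l, p = a :: b :: l ∧ G.undir a b

/-- There is no proper possibly causal path from `X` to `Y` in `G` that starts with
an undirected edge. -/
def NoProperPCUndirStart (G : PDG V) (X Y : Finset V) : Prop :=
  ¬ ∃ p, G.PossiblyCausal p ∧ ProperFrom X p ∧ EndsIn Y p ∧ G.StartsUndirected p

/-- `A` is an undirected connected node set in `G`: every two distinct nodes of `A`
are joined by an undirected path in `G`. -/
def UndirConnected (G : PDG V) (A : Finset V) : Prop :=
  ∀ a ∈ A, ∀ b ∈ A, a ≠ b →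
    ∃ p, G.IsUndirPath p ∧ p.head? = some a ∧ p.getLast? = some b

/-- `B` is a bucket in `D`: a maximal undirected connected subset of `D` in `G`. -/
def Bucket (G : PDG V) (B D : Finset V) : Prop :=
  B.Nonempty ∧ B ⊆ D ∧ G.UndirConnected B ∧
    ∀ B' : Finset V, B ⊆ B' → B' ⊆ D → G.UndirConnected B' → B' = B

section DecEq

variable [DecidableEq V]

/-- `Bs` lists the bucket decomposition of `D`: the listed sets are buckets in `D`,
pairwise disjoint, with union `D`. -/
def IsBucketDecompList (G : PDG V) (D : Finset V) (Bs : List (Finset V)) : Prop :=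
  (∀ B ∈ Bs, G.Bucket B D) ∧ (Bs.Pairwise fun B B' => Disjoint B B') ∧
    Bs.foldr (· ∪ ·) ∅ = D

end DecEq

/-- The listed node sets are totally ordered as a partial causal ordering in `G` :
every edge between an earlier set and a later one points towards the later one. -/
def OrderedDecomp (G : PDG V) (Bs : List (Finset V)) : Prop :=
  ∀ i j : Fin Bs.length, (i : ℕ) < (j : ℕ) →
    ∀ a ∈ Bs.get i, ∀ b ∈ Bs.get j, G.Adj a b → G.dir a b

/-- the node at (interior) position `i` of `p` is a collider on `p`. -/
def ColliderAt (G : PDG V) (p : List V) (i : ℕ) : Prop :=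
  ∃ u v w, p[i-1]? = some u ∧ p[i]? = some v ∧ p[i+1]? = some w ∧
    1 ≤ i ∧ G.dir u v ∧ G.dir w v

/-- the node at (interior) position `i` of `p` is a definite non-collider on `p`. -/
def DefNonColliderAt (G : PDG V) (p : List V) (i : ℕ) : Prop :=
  ∃ u v w, p[i-1]? = some u ∧ p[i]? = some v ∧ p[i+1]? = some w ∧ 1 ≤ i ∧
    (G.dir v u ∨ G.dir v w ∨ (G.undir u v ∧ G.undir v w ∧ ¬ G.Adj u w))

/-- `p` is a definite status path: every interior node is a collider or a definite
non-collider on `p`. -/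
def DefiniteStatus (G : PDG V) (p : List V) : Prop :=
  ∀ i : ℕ, 1 ≤ i → i + 1 < p.length → G.ColliderAt p i ∨ G.DefNonColliderAt p i

/-- `p` is d-connecting given `Z` (in a DAG): every non-collider on `p` is outside
`Z` and every collider on `p` has a descendant in `Z`. -/
def DConnGiven (G : PDG V) (Z : Finset V) (p : List V) : Prop :=
  (∀ i u, 1 ≤ i → i + 1 < p.length → p[i]? = some u → ¬ G.ColliderAt p i → u ∉ Z) ∧
  (∀ i u, G.ColliderAt p i → p[i]? = some u →
    ∃ z ∈ Z, Relation.ReflTransGen G.dir u z)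

/-- `A` and `B` are d-separated given `Z` : no path between them is d-connecting
given `Z`. -/
def DSep (G : PDG V) (A B Z : Finset V) : Prop :=
  ∀ p a b, a ∈ A → b ∈ B → G.IsPathFrom p a b → ¬ G.DConnGiven Z p

/-- `p` is d-connecting given `Z` (definite status version): every definite
non-collider on `p` is outside `Z` and every collider on `p` has a descendant in `Z`. -/
def DConnDS (G : PDG V) (Z : Finset V) (p : List V) : Prop :=
  (∀ i u, G.DefNonColliderAt p i → p[i]? = some u → u ∉ Z) ∧
  (∀ i u, G.ColliderAt p i → p[i]? = some u →
    ∃ z ∈ Z, Relation.ReflTransGen G.dir u z)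

/-- `Z` blocks the (definite status) path `p`. -/
def Blocks (G : PDG V) (Z : Finset V) (p : List V) : Prop := ¬ G.DConnDS Z p

/-- `D_{X̄}` : remove all edges into `X`. -/
def removeInto (D : PDG V) (X : Finset V) : PDG V where
  dir a b := D.dir a b ∧ b ∉ X
  undir := D.undir
  undir_symm := D.undir_symm
  dir_irrefl := fun a h => D.dir_irrefl a h.1
  undir_irrefl := D.undir_irrefl
  dir_asymm := fun a b h h' => D.dir_asymm a b h.1 h'.1
  dir_not_undir := fun a b h => D.dir_not_undir a b h.1

/-- `D_{X̲}` : remove all edges out of `X`. -/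
def removeOutOf (D : PDG V) (X : Finset V) : PDG V where
  dir a b := D.dir a b ∧ a ∉ X
  undir := D.undir
  undir_symm := D.undir_symm
  dir_irrefl := fun a h => D.dir_irrefl a h.1
  undir_irrefl := D.undir_irrefl
  dir_asymm := fun a b h h' => D.dir_asymm a b h.1 h'.1
  dir_not_undir := fun a b h => D.dir_not_undir a b h.1

/-- `w'` is a possible descendant of `w` in `G`. -/
def PossibleDesc (G : PDG V) (w w' : V) : Prop :=
  w = w' ∨ ∃ p, G.PossiblyCausal p ∧ p.head? = some w ∧ p.getLast? = some w'

section Fin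

variable [Fintype V] [DecidableEq V]

/-- the parents of the node `v` in `G`. -/
def paFin (G : PDG V) (v : V) : Finset V := Finset.univ.filter fun u => G.dir u v

/-- `Pa(S, G)` : the parents of the node set `S` in `G`, excluding `S` itself. -/
def PaFin (G : PDG V) (S : Finset V) : Finset V :=
  (Finset.univ.filter fun u => ∃ v ∈ S, G.dir u v) \ S

/-- `a` is an ancestor of `y` within the induced subgraph of `G` on `S`
(every node is an ancestor of itself). -/
def AncestorIn (G : PDG V) (S : Finset V) (a y : V) : Prop :=
  a ∈ S ∧ y ∈ S ∧ Relation.ReflTransGen (fun u v => G.dir u v ∧ u ∈ S ∧ v ∈ S) a y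

/-- `An(Y, G_S)` : the ancestors of `Y` in the induced subgraph of `G` on `S`. -/
def AnIn (G : PDG V) (Y S : Finset V) : Finset V :=
  Finset.univ.filter fun a => ∃ y ∈ Y, G.AncestorIn S a y

/-- `forb(X, Y, G)` for single nodes `X`, `Y` : all possible descendants of nodes
`W ≠ X` lying on a proper possibly causal path from `X` to `Y` in `G`. -/
def Forb (G : PDG V) (X Y : V) : Finset V :=
  Finset.univ.filter fun w' => ∃ w, w ≠ X ∧
    (∃ p, G.PossiblyCausal p ∧ p.head? = some X ∧ p.getLast? = some Y ∧ w ∈ p) ∧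
    G.PossibleDesc w w'

end Fin

end PDG

section Density

open PDG

variable {V : Type} [Fintype V] [DecidableEq V] {Ω : Type} [Fintype Ω] [DecidableEq Ω]

/-- the marginal of `f` over the node set `S`, at the values given by `g`. -/
def margin (f : (V → Ω) → ℝ) (S : Finset V) (g : V → Ω) : ℝ :=
  ∑ h : V → Ω, if ∀ v ∈ S, h v = g v then f h else 0

/-- the conditional density `f(a | b)` of `A` given `B`, at the values given by `g`. -/
def condOn (f : (V → Ω) → ℝ) (A B : Finset V) (g : V → Ω) : ℝ :=
  margin f (A ∪ B) g / margin f B g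

/-- `f` is a strictly positive discrete density over `V`. -/
def IsPosDensity (f : (V → Ω) → ℝ) : Prop :=
  (∀ g, 0 < f g) ∧ ∑ g : V → Ω, f g = 1

/-- `f` is consistent with the DAG `D` : it factorizes according to `D`. -/
def ConsistentWith (f : (V → Ω) → ℝ) (D : PDG V) : Prop :=
  ∀ g, f g = ∏ v : V, condOn f {v} (D.paFin v) g

/-- the interventional density obtained from `f` by truncated factorization with
respect to the DAG `D` under `do(X = x)`, evaluated at `g` (parent values in `X`
are taken in agreement with `x`). -/
def doDens (f : (V → Ω) → ℝ) (D : PDG V) (X : Finset V) (x : V → Ω) (g : V → Ω) : ℝ :=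
  ∏ v ∈ Finset.univ \ X, condOn f {v} (D.paFin v) fun u => if u ∈ X then x u else g u

/-- `f(y | do(x))` : the marginal over `Y` of the interventional density obtained
from `f` by truncated factorization with respect to `D`. -/
def doMargin (f : (V → Ω) → ℝ) (D : PDG V) (X : Finset V) (x : V → Ω)
    (Y : Finset V) (y : V → Ω) : ℝ :=
  ∑ g : V → Ω,
    if (∀ v ∈ X, g v = x v) ∧ (∀ v ∈ Y, g v = y v) then doDens f D X x g else 0

end Density

open PDG

namespace PDG

/-- An edge that is undirected in `G` and oriented `a → b` in `D`. -/
def UndirOriented (G D : PDG V) (a b : V) : Prop := D.dir a b ∧ G.undir a b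

/-- An edge `a → b` of `D` with `b` outside `X`. -/
def DirAvoiding (D : PDG V) (X : Finset V) (a b : V) : Prop := D.dir a b ∧ b ∉ X

section General

variable {V : Type} {G D : PDG V}

lemma Adj.symm {a b : V} (h : G.Adj a b) : G.Adj b a := by
  rcases h with h | h | h
  · exact Or.inr (Or.inl h)
  · exact Or.inl h
  · exact Or.inr (Or.inr (G.undir_symm _ _ h))

lemma IsMPDAG.transGen_or_undir (hG : G.IsMPDAG) {a t w : V}
    (h : Relation.TransGen G.dir a t) (hw : G.undir t w) :
    Relation.TransGen G.dir a w ∨ G.undir a w := by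
  have step : ∀ {s t}, G.dir s t → G.undir t w → G.dir s w ∨ G.undir s w := by
    intro s t hst htw
    rcases hG.meek1 s t w hst htw with h | h | h
    · exact Or.inl h
    · exact absurd (G.undir_symm _ _ htw) (hG.meek2 w s t h hst)
    · exact Or.inr h
  induction h with
  | single h => exact (step h hw).imp_left .single
  | tail h₁ h₂ ih =>
    rcases step h₂ hw with h | h
    · exact Or.inl (h₁.tail h)
    · exact ih h

lemma IsMPDAG.not_undir_of_transGen (hG : G.IsMPDAG) {a t : V}
    (h : Relation.TransGen G.dir a t) : ¬ G.undir a t := fun hu =>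
  (hG.transGen_or_undir h (G.undir_symm _ _ hu)).elim (hG.acyclic a) (G.undir_irrefl a)

lemma IsMPDAG.dir_of_transGen_of_adj (hG : G.IsMPDAG) {a t : V}
    (h : Relation.TransGen G.dir a t) (hadj : G.Adj a t) : G.dir a t := by
  rcases hadj with h' | h' | h'
  · exact h'
  · exact absurd (h.tail h') (hG.acyclic a)
  · exact absurd h' (hG.not_undir_of_transGen h)

lemma IsMPDAG.dir_of_transGen_of_common_undir (hG : G.IsMPDAG) {a t w : V}
    (h : Relation.TransGen G.dir a t) (haw : G.undir a w) (htw : G.undir t w) :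
    G.dir a t := by
  induction h with
  | single h => exact h
  | @tail s t h₁ h₂ ih =>
    have hsw : G.undir s w := by
      rcases hG.meek1 s t w h₂ htw with h | h | h
      · exact absurd haw (hG.not_undir_of_transGen (h₁.tail h))
      · exact absurd (G.undir_symm _ _ htw) (hG.meek2 w s t h h₂)
      · exact h
    exact hG.dir_of_transGen_of_adj (h₁.tail h₂)
      (hG.meek4 w a t s (G.undir_symm _ _ haw) (G.undir_symm _ _ htw) (G.undir_symm _ _ hsw)
        (ih hsw) h₂)

/-- A node that is both a proper ancestor of `w` and joined to `w` by undirected edges is a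
parent of `w`. -/
lemma IsMPDAG.dir_of_transGen_of_undirReachable (hG : G.IsMPDAG) {a w : V}
    (hu : Relation.ReflTransGen G.undir w a) (h : Relation.TransGen G.dir a w) :
    G.dir a w := by
  induction hu using Relation.ReflTransGen.head_induction_on with
  | refl => exact absurd h (hG.acyclic a)
  | @head w w' hww' _ ih =>
    rcases hG.transGen_or_undir h hww' with h' | h'
    · exact hG.dir_of_transGen_of_adj h
        (hG.meek1 a w' w (ih h') (G.undir_symm _ _ hww'))
    · exact hG.dir_of_transGen_of_common_undir h h' hww'

lemma IsMPDAG.dir_or_undir_of_undirReachable (hG : G.IsMPDAG) {c t b : V}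
    (h : G.dir c t) (hu : Relation.ReflTransGen G.undir t b) :
    G.dir c b ∨ Relation.ReflTransGen G.undir c b := by
  induction hu using Relation.ReflTransGen.head_induction_on with
  | refl => exact Or.inl h
  | @head t t' htt' htb ih =>
    rcases hG.meek1 c t t' h htt' with h' | h' | h'
    · exact ih h'
    · exact absurd (G.undir_symm _ _ htt') (hG.meek2 t' c t h' h)
    · exact Or.inr (htb.head h')

lemma InClassOf.acyclic (hD : D.InClassOf G) : D.Acyclic := hD.1.2

lemma InClassOf.dir_of_dir (hD : D.InClassOf G) {a b : V} (h : G.dir a b) : D.dir a b :=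
  hD.2.2.2 a b h

lemma InClassOf.dir_or_dir_of_adj (hD : D.InClassOf G) {a b : V} (h : G.Adj a b) :
    D.dir a b ∨ D.dir b a := by
  rcases (hD.2.1 a b).1 h with h | h | h
  · exact Or.inl h
  · exact Or.inr h
  · exact absurd h (hD.1.1 a b)

lemma InClassOf.dir_or_undir_of_dir (hD : D.InClassOf G) {a b : V} (h : D.dir a b) :
    G.dir a b ∨ G.undir a b := by
  rcases (hD.2.1 a b).2 (Or.inl h) with h' | h' | h'
  · exact Or.inl h'
  · exact absurd (hD.dir_of_dir h') (D.dir_asymm _ _ h)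
  · exact Or.inr h'

lemma InClassOf.dir_of_adj_of_transGen (hD : D.InClassOf G) {a b : V}
    (hadj : G.Adj a b) (h : Relation.TransGen D.dir a b) : D.dir a b :=
  (hD.dir_or_dir_of_adj hadj).resolve_right fun h' => hD.acyclic a (h.tail h')

lemma InClassOf.dir_of_collider (hD : D.InClassOf G) {a c v : V} (hne : a ≠ v)
    (hadj : ¬ G.Adj a v) (ha : D.dir a c) (hv : D.dir v c) : G.dir a c ∧ G.dir v c := by
  have h := (hD.2.2.1 a c v).2 ⟨hne, ha, hv, fun h => hadj ((hD.2.1 a v).2 h)⟩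
  exact ⟨h.2.1, h.2.2.1⟩

lemma IsMPDAG.dir_or_undirOriented (hG : G.IsMPDAG) (hD : D.InClassOf G) {c t b : V}
    (h : G.dir c t) (hu : Relation.ReflTransGen (UndirOriented G D) t b) :
    G.dir c b ∨ Relation.ReflTransGen (UndirOriented G D) c b := by
  induction hu using Relation.ReflTransGen.head_induction_on with
  | refl => exact Or.inl h
  | @head t t' htt' htb ih =>
    have hadj := hG.meek1 c t t' h htt'.2
    have hd := hD.dir_of_adj_of_transGen hadj (.tail (.single (hD.dir_of_dir h)) htt'.1)
    rcases hD.dir_or_undir_of_dir hd with h' | h'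
    · exact ih h'
    · exact Or.inr (htb.head ⟨hd, h'⟩)

/-- A directed path of `D` can be replaced by one that is first undirected and then directed
in `G`. -/
lemma IsMPDAG.exists_undirOriented_dir (hG : G.IsMPDAG) (hD : D.InClassOf G) {c z : V}
    (h : Relation.ReflTransGen D.dir c z) :
    ∃ c', Relation.ReflTransGen (UndirOriented G D) c c' ∧
      Relation.ReflTransGen G.dir c' z := by
  induction h using Relation.ReflTransGen.head_induction_on with
  | refl => exact ⟨z, .refl, .refl⟩
  | @head c t hct _ ih =>
    obtain ⟨t', htt', ht'z⟩ := ih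
    rcases hD.dir_or_undir_of_dir hct with h | h
    · rcases hG.dir_or_undirOriented hD h htt' with h' | h'
      · exact ⟨c, .refl, ht'z.head h'⟩
      · exact ⟨t', h', ht'z⟩
    · exact ⟨t', htt'.head ⟨hct, h⟩, ht'z⟩

/-- A parent of an unshielded collider is an ancestor in `G` of every descendant in `D` of the
collider. -/
lemma IsMPDAG.transGen_of_unshielded_collider (hG : G.IsMPDAG) (hD : D.InClassOf G)
    {a c v z : V} (hne : a ≠ v) (hadj : ¬ G.Adj a v) (ha : D.dir a c) (hv : D.dir v c)
    (h : Relation.ReflTransGen D.dir c z) : Relation.TransGen G.dir a z := by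
  obtain ⟨c', hcc', hc'z⟩ := hG.exists_undirOriented_dir hD h
  have key : G.dir a c' ∧ G.dir v c' := by
    clear hc'z
    induction hcc' with
    | refl => exact hD.dir_of_collider hne hadj ha hv
    | @tail s t _ hst ih =>
      have hd : ∀ {u}, G.dir u s → D.dir u t := fun hus =>
        hD.dir_of_adj_of_transGen (hG.meek1 _ _ _ hus hst.2)
          (.tail (.single (hD.dir_of_dir hus)) hst.1)
      exact hD.dir_of_collider hne hadj (hd ih.1) (hd ih.2)
  exact .head' key.1 hc'z

lemma exists_isUndirPath {a b : V} (h : Relation.ReflTransGen G.undir a b) :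
    ∃ p, G.IsUndirPath p ∧ p.head? = some a ∧ p.getLast? = some b := by
  induction h using Relation.ReflTransGen.head_induction_on with
  | refl => exact ⟨[b], ⟨by simp, by simp, .singleton b⟩, by simp, by simp⟩
  | @head a c hac _ ih =>
    obtain ⟨p, ⟨hne, hnd, hch⟩, hhd, hlast⟩ := ih
    by_cases hmem : a ∈ p
    · obtain ⟨l₁, l₂, rfl⟩ := List.append_of_mem hmem
      refine ⟨a :: l₂, ⟨by simp, hnd.of_append_right, hch.right_of_append⟩, by simp, ?_⟩
      simpa [List.getLast?_append] using hlast
    · cases p with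
      | nil => exact absurd rfl hne
      | cons d l =>
        obtain rfl : d = c := by simpa using hhd
        exact ⟨a :: d :: l, ⟨by simp, List.nodup_cons.2 ⟨hmem, hnd⟩,
          List.IsChain.cons_cons hac hch⟩, by simp, by simpa using hlast⟩

lemma IsUndirPath.reflTransGen {p : List V} {a b : V} (hp : G.IsUndirPath p)
    (ha : p.head? = some a) (hb : p.getLast? = some b) :
    Relation.ReflTransGen G.undir a b := by
  obtain ⟨_, -, hch⟩ := hp
  induction p generalizing a with
  | nil => simp at ha
  | cons c l ih =>
    obtain rfl : c = a := by simpa using ha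
    cases l with
    | nil =>
      obtain rfl : c = b := by simpa using hb
      exact .refl
    | cons d l =>
      replace hch := List.isChain_cons_cons.1 hch
      exact .head hch.1 (ih (by simp) (by simpa using hb) (by simp) hch.2)

lemma UndirConnected.reflTransGen {B : Finset V} (hB : G.UndirConnected B) {a b : V}
    (ha : a ∈ B) (hb : b ∈ B) : Relation.ReflTransGen G.undir a b := by
  by_cases hab : a = b
  · exact hab ▸ .refl
  · obtain ⟨p, hp, hhd, hlast⟩ := hB a ha b hb hab
    exact hp.reflTransGen hhd hlast

lemma reflTransGen_undir_symm {a b : V} (h : Relation.ReflTransGen G.undir a b) :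
    Relation.ReflTransGen G.undir b a := by
  induction h with
  | refl => exact .refl
  | tail _ h ih => exact ih.head (G.undir_symm _ _ h)

lemma Bucket.mem_of_undirReachable [DecidableEq V] {B A : Finset V} (hB : G.Bucket B A)
    {z b : V} (hz : z ∈ A) (hb : b ∈ B) (h : Relation.ReflTransGen G.undir z b) : z ∈ B := by
  have hall : ∀ c ∈ insert z B, Relation.ReflTransGen G.undir c b := by
    intro c hc
    rcases Finset.mem_insert.1 hc with rfl | hc
    · exact h
    · exact hB.2.2.1.reflTransGen hc hb
  have := hB.2.2.2 (insert z B) (Finset.subset_insert _ _)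
    (Finset.insert_subset hz hB.2.1) fun c hc d hd _ =>
      exists_isUndirPath ((hall c hc).trans (reflTransGen_undir_symm (hall d hd)))
  exact this ▸ Finset.mem_insert_self z B

lemma NoProperPCUndirStart.not_undirOriented {X Y : Finset V}
    (hno : G.NoProperPCUndirStart X Y) (hD : D.InClassOf G) {x w y : V} (hx : x ∈ X)
    (hxw : UndirOriented G D x w) (hw : w ∉ X)
    (hwy : Relation.ReflTransGen (DirAvoiding D X) w y) (hy : y ∈ Y) : False := by
  obtain ⟨l, hl, hlast⟩ := List.exists_isChain_cons_of_relationReflTransGen hwy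
  have hD' : List.IsChain D.dir (x :: w :: l) :=
    List.IsChain.cons_cons hxw.1 (hl.imp fun _ _ h => h.1)
  have hpw : (x :: w :: l).Pairwise (Relation.TransGen D.dir) :=
    List.isChain_iff_pairwise.1 (hD'.imp fun _ _ h => .single h)
  have hX : ∀ v ∈ w :: l, v ∉ X := by
    have : ∀ (l : List V) (w : V), w ∉ X → List.IsChain (DirAvoiding D X) (w :: l) →
        ∀ v ∈ w :: l, v ∉ X := by
      intro l
      induction l with
      | nil => simp
      | cons d l ih =>
        intro w hw hl v hv
        rw [List.isChain_cons_cons] at hl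
        rcases List.mem_cons.1 hv with rfl | hv
        · exact hw
        · exact ih d hl.1.2 hl.2 v hv
    exact this l w hw hl
  refine hno ⟨x :: w :: l, ⟨⟨by simp, ?_, ?_⟩, ?_⟩, ⟨⟨x, hx, rfl⟩, ?_⟩, ⟨y, hy, ?_⟩,
    ⟨x, w, l, rfl, hxw.2⟩⟩
  · refine hpw.imp ?_
    rintro a _ h rfl
    exact hD.acyclic a h
  · exact hD'.imp fun _ _ h => (hD.2.1 _ _).2 (Or.inl h)
  · intro i j hij hji
    exact hD.acyclic _ ((List.pairwise_iff_get.1 hpw i j hij).tail (hD.dir_of_dir hji))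
  · intro i hi
    obtain ⟨i, hi'⟩ := i
    cases i with
    | zero => simp at hi
    | succ i => exact hX _ (List.get_mem (w :: l) ⟨i, by simpa using hi'⟩)
  · rw [List.getLast?_cons_cons, List.getLast?_eq_getLast_of_ne_nil (by simp), hlast]

lemma NoProperPCUndirStart.dirAvoiding_of_undirOriented (hD : D.InClassOf G)
    {X Y : Finset V} (hno : G.NoProperPCUndirStart X Y) {a b y : V} (hb : b ∉ X) (hy : y ∈ Y)
    (hby : Relation.ReflTransGen (DirAvoiding D X) b y)
    (hab : Relation.ReflTransGen (UndirOriented G D) a b) :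
    a ∉ X ∧ Relation.ReflTransGen (DirAvoiding D X) a y := by
  induction hab using Relation.ReflTransGen.head_induction_on with
  | refl => exact ⟨hb, hby⟩
  | head h _ ih =>
    exact ⟨fun ha => hno.not_undirOriented hD ha h ih.1 ih.2 hy, ih.2.head ⟨h.1, ih.1⟩⟩

lemma NoProperPCUndirStart.transGen_of_dirAvoiding (hG : G.IsMPDAG) (hD : D.InClassOf G)
    {X Y : Finset V} (hno : G.NoProperPCUndirStart X Y) {x s y : V} (hx : x ∈ X) (hs : s ∉ X)
    (hy : y ∈ Y)
    (hxs : Relation.ReflTransGen (DirAvoiding D X) x s)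
    (hsy : Relation.ReflTransGen (DirAvoiding D X) s y) : Relation.TransGen G.dir x s := by
  suffices ∀ t, Relation.ReflTransGen (DirAvoiding D X) x t →
      Relation.ReflTransGen (DirAvoiding D X) t y → x = t ∨ Relation.TransGen G.dir x t from
    (this s hxs hsy).resolve_left fun h => hs (h ▸ hx)
  intro t hxt
  induction hxt with
  | refl => exact fun _ => Or.inl rfl
  | @tail t t' _ htt' ih =>
    intro ht'y
    have hnot : ¬ UndirOriented G D x t' := fun h =>
      hno.not_undirOriented hD hx h htt'.2 ht'y hy
    refine Or.inr ?_
    rcases ih (ht'y.head htt') with rfl | hxt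
    · exact .single ((hD.dir_or_undir_of_dir htt'.1).resolve_right fun h => hnot ⟨htt'.1, h⟩)
    · rcases hD.dir_or_undir_of_dir htt'.1 with h | h
      · exact hxt.tail h
      · refine (hG.transGen_or_undir hxt h).resolve_right fun h' => hnot ⟨?_, h'⟩
        exact hD.dir_of_adj_of_transGen (Or.inr (Or.inr h'))
          (.tail (Relation.TransGen.mono (fun _ _ => hD.dir_of_dir) _ _ hxt) htt'.1)

end General

/-- `a` is a descendant of a node outside the parents of `B` that is joined to `B` by undirected
edges. -/
def UndirDirReachable {V : Type} [Fintype V] [DecidableEq V] (G : PDG V) (B : Finset V) (a : V) :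
    Prop :=
  ∃ w, w ∉ G.PaFin B ∧ (∃ b ∈ B, Relation.ReflTransGen G.undir w b) ∧
    Relation.ReflTransGen G.dir w a

lemma mem_AnIn_iff {V : Type} [Fintype V] {G : PDG V} {Y S : Finset V} {a : V} :
    a ∈ G.AnIn Y S ↔ ∃ y ∈ Y, G.AncestorIn S a y := by
  simp [AnIn]

section Parents

variable {V : Type} [Fintype V] [DecidableEq V] {G D : PDG V} {B X Y : Finset V}

lemma notMem_PaFin_of_mem {b : V} (hb : b ∈ B) : b ∉ G.PaFin B := by simp [PaFin, hb]

lemma mem_of_dir_of_notMem_PaFin {v b : V} (hb : b ∈ B) (h : G.dir v b) (hv : v ∉ G.PaFin B) :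
    v ∈ B := by
  by_contra hvB
  exact hv (by simpa [PaFin, hvB] using ⟨b, hb, h⟩)

lemma UndirDirReachable.of_undir {v b : V} (hv : v ∉ G.PaFin B) (hb : b ∈ B)
    (h : Relation.ReflTransGen G.undir v b) : G.UndirDirReachable B v :=
  ⟨v, hv, ⟨b, hb, h⟩, .refl⟩

lemma UndirDirReachable.not_transGen (hG : G.IsMPDAG) {a z : V}
    (ha : G.UndirDirReachable B a) (hz : ∀ b ∈ B, Relation.TransGen G.dir z b) :
    ¬ Relation.TransGen G.dir a z := by
  intro haz
  obtain ⟨w, hw, ⟨b, hb, hwb⟩, hwa⟩ := ha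
  have hwz := Relation.TransGen.trans_right hwa haz
  have hdir := hG.dir_of_transGen_of_undirReachable (reflTransGen_undir_symm hwb)
    (hwz.trans (hz b hb))
  exact hG.acyclic z ((hz w (mem_of_dir_of_notMem_PaFin hb hdir hw)).trans hwz)

lemma UndirDirReachable.of_undir_right (hG : G.IsMPDAG) {a v : V}
    (ha : G.UndirDirReachable B a) (hav : G.undir a v) (hv : v ∉ G.PaFin B) :
    G.UndirDirReachable B v := by
  obtain ⟨w, hw, ⟨b, hb, hwb⟩, hwa⟩ := ha
  rcases Relation.reflTransGen_iff_eq_or_transGen.1 hwa with rfl | hwa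
  · exact .of_undir hv hb (hwb.head (G.undir_symm _ _ hav))
  · rcases hG.transGen_or_undir hwa hav with h | h
    · exact ⟨w, hw, ⟨b, hb, hwb⟩, h.to_reflTransGen⟩
    · exact .of_undir hv hb (hwb.head (G.undir_symm _ _ h))

lemma UndirDirReachable.of_dir (hG : G.IsMPDAG) (hD : D.InClassOf G) {a v : V}
    (ha : G.UndirDirReachable B a) (hav : D.dir a v) (hv : v ∉ G.PaFin B) :
    G.UndirDirReachable B v := by
  rcases hD.dir_or_undir_of_dir hav with h | h
  · obtain ⟨w, hw, hwb, hwa⟩ := ha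
    exact ⟨w, hw, hwb, hwa.tail h⟩
  · exact ha.of_undir_right hG h hv

lemma UndirDirReachable.of_dir_left (hG : G.IsMPDAG) (hD : D.InClassOf G) {a v z : V}
    (ha : G.UndirDirReachable B a) (hz : ∀ b ∈ B, Relation.TransGen G.dir z b)
    (haz : Relation.ReflTransGen D.dir a z) (hva : D.dir v a) (hv : v ∉ G.PaFin B) :
    G.UndirDirReachable B v := by
  obtain ⟨w, hw, ⟨b, hb, hwb⟩, hwa⟩ := ha
  induction hwa with
  | refl =>
    rcases hD.dir_or_undir_of_dir hva with h | h
    · rcases hG.dir_or_undir_of_undirReachable h hwb with h' | h'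
      · exact .of_undir hv (mem_of_dir_of_notMem_PaFin hb h' hv) .refl
      · exact .of_undir hv hb h'
    · exact .of_undir hv hb (hwb.head h)
  | @tail a' a hwa' ha'a ih =>
    have ha' : G.UndirDirReachable B a' := ⟨w, hw, ⟨b, hb, hwb⟩, hwa'⟩
    have ha'd := hD.dir_of_dir ha'a
    by_cases hne : a' = v
    · exact hne ▸ ha'
    by_cases hadj : G.Adj a' v
    · rcases hD.dir_or_dir_of_adj hadj with h | h
      · exact ha'.of_dir hG hD h hv
      · exact ih (haz.head ha'd) h
    · exact absurd (hG.transGen_of_unshielded_collider hD hne hadj ha'd hva haz)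
        (ha'.not_transGen hG hz)

lemma UndirDirReachable.of_collider (hG : G.IsMPDAG) (hD : D.InClassOf G) {a c v z : V}
    (ha : G.UndirDirReachable B a) (hz : ∀ b ∈ B, Relation.TransGen G.dir z b)
    (hac : D.dir a c) (hvc : D.dir v c) (hcz : Relation.ReflTransGen D.dir c z)
    (hv : v ∉ G.PaFin B) : G.UndirDirReachable B v := by
  by_cases hne : a = v
  · exact hne ▸ ha
  by_cases hadj : G.Adj a v
  · rcases hD.dir_or_dir_of_adj hadj with h | h
    · exact ha.of_dir hG hD h hv
    · exact ha.of_dir_left hG hD hz (hcz.head hac) h hv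
  · exact absurd (hG.transGen_of_unshielded_collider hD hne hadj hac hvc hcz)
      (ha.not_transGen hG hz)

lemma exists_mem_dirAvoiding_PaFin (hG : G.IsMPDAG) (hD : D.InClassOf G) {x s : V}
    (hx : x ∈ X) (hxB : x ∉ G.PaFin B) (ha : G.UndirDirReachable B x)
    (hs : s ∈ G.PaFin B)
    (hxs : Relation.ReflTransGen (D.removeInto (X ∩ G.PaFin B)).dir x s) :
    ∃ x' ∈ X, G.UndirDirReachable B x' ∧
      ∃ s' ∈ G.PaFin B, s' ∉ X ∧ Relation.ReflTransGen (DirAvoiding D X) x' s' := by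
  suffices ∀ a, Relation.ReflTransGen (D.removeInto (X ∩ G.PaFin B)).dir a s →
      G.UndirDirReachable B a → a ∉ G.PaFin B →
      (∃ x' ∈ X, G.UndirDirReachable B x' ∧
        ∃ s' ∈ G.PaFin B, s' ∉ X ∧ Relation.ReflTransGen (DirAvoiding D X) x' s') ∨
      ∃ s' ∈ G.PaFin B, s' ∉ X ∧ Relation.ReflTransGen (DirAvoiding D X) a s' from
    (this x hxs ha hxB).elim id fun h => ⟨x, hx, ha, h⟩
  intro a has
  induction has using Relation.ReflTransGen.head_induction_on with
  | refl => exact fun _ h => absurd hs h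
  | @head a a' haa' _ ih =>
    intro ha haB
    by_cases ha'B : a' ∈ G.PaFin B
    · have ha'X : a' ∉ X := fun h => haa'.2 (Finset.mem_inter.2 ⟨h, ha'B⟩)
      exact Or.inr ⟨a', ha'B, ha'X, .single ⟨haa'.1, ha'X⟩⟩
    · have ha' := ha.of_dir hG hD haa'.1 ha'B
      rcases ih ha' ha'B with h | ⟨s', hs', hs'X, h⟩
      · exact Or.inl h
      · by_cases ha'X : a' ∈ X
        · exact Or.inl ⟨a', ha'X, ha', s', hs', hs'X, h⟩
        · exact Or.inr ⟨s', hs', hs'X, h.head ⟨haa'.1, ha'X⟩⟩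

/-- `B` is d-separated from `X \ Pa(B, G)` given `Pa(B, G)` in `D.removeInto S`, where `S` contains
`X ∩ Pa(B, G)` and every node of `X \ Pa(B, G)` that is not an ancestor of `Pa(B, G)`. -/
lemma dSep_removeInto_PaFin (hG : G.IsMPDAG) (hD : D.InClassOf G)
    (hno : G.NoProperPCUndirStart X Y) {S : Finset V} (hXS : X ∩ G.PaFin B ⊆ S)
    (hS : ∀ x ∈ X, x ∉ G.PaFin B → x ∉ S → ∃ s ∈ G.PaFin B,
      Relation.ReflTransGen (D.removeInto (X ∩ G.PaFin B)).dir x s)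
    (hBX : ∀ b ∈ B, b ∉ X)
    (hBY : ∀ b ∈ B, ∃ y ∈ Y, Relation.ReflTransGen (DirAvoiding D X) b y)
    (hPa : ∀ z ∈ G.PaFin B, z ∉ X → ∀ b ∈ B, Relation.TransGen G.dir z b) :
    (D.removeInto S).DSep B (X \ G.PaFin B) (G.PaFin B) := by
  rintro p b₀ x hb₀ hx ⟨⟨hlen, -, hch⟩, hhd, hlast⟩ ⟨hnc, hcol⟩
  obtain ⟨hxX, hxB⟩ := Finset.mem_sdiff.1 hx
  set H := D.removeInto S with hH
  set Z := G.PaFin B with hZ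
  have hHD : ∀ {a b}, H.dir a b → D.dir a b := fun h => h.1
  have hHD' : ∀ {a b}, Relation.ReflTransGen H.dir a b → Relation.ReflTransGen D.dir a b :=
    fun h => Relation.ReflTransGen.mono (fun _ _ => hHD) _ _ h
  have hedge : ∀ i (h : i + 1 < p.length), H.dir p[i] p[i + 1] ∨ H.dir p[i + 1] p[i] := by
    intro i h
    rcases List.isChain_iff_getElem.1 hch i h with h | h | h
    · exact Or.inl h
    · exact Or.inr h
    · exact absurd h (hD.1.1 _ _)
  have hzero : p[0] = b₀ := by
    rw [List.head?_eq_getElem?] at hhd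
    exact (List.getElem?_eq_some_iff.1 hhd).2
  have hend : p[p.length - 1] = x := by
    rw [List.getLast?_eq_getElem?] at hlast
    exact (List.getElem?_eq_some_iff.1 hlast).2
  have hout : ∀ i (h : i < p.length), 1 ≤ i →
      (∀ h' : i + 1 < p.length, ¬ (H.dir p[i - 1] p[i] ∧ H.dir p[i + 1] p[i])) → p[i] ∉ Z := by
    intro i h hi hnot
    by_cases h' : i + 1 < p.length
    · refine hnc i _ hi h' (List.getElem?_eq_getElem h) ?_
      rintro ⟨u, v, w, hu, hv, hw, -, huv, hwv⟩
      obtain ⟨_, rfl⟩ := List.getElem?_eq_some_iff.1 hu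
      obtain ⟨_, rfl⟩ := List.getElem?_eq_some_iff.1 hv
      obtain ⟨_, rfl⟩ := List.getElem?_eq_some_iff.1 hw
      exact hnot h' ⟨huv, hwv⟩
    · obtain rfl : i = p.length - 1 := by omega
      rwa [hend]
  have hback : ∀ i (h : i + 1 < p.length), H.dir p[i + 1] p[i] → p[i + 1] ∉ Z := by
    intro i h hd
    exact hout (i + 1) h (by omega) fun _ h' => H.dir_asymm _ _ hd h'.1
  have hcollider : ∀ i (h : i + 2 < p.length), H.dir p[i] p[i + 1] → H.dir p[i + 2] p[i + 1] →
      ∃ z ∈ Z, z ∉ X ∧ Relation.ReflTransGen H.dir p[i + 1] z := by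
    intro i h h₁ h₂
    obtain ⟨z, hz, hd⟩ := hcol (i + 1) p[i + 1]
      ⟨p[i], p[i + 1], p[i + 2], by simp, by simp, by simp, by omega, h₁, h₂⟩ (by simp)
    refine ⟨z, hz, fun hzX => ?_, hd⟩
    have hzS : z ∈ S := hXS (Finset.mem_inter.2 ⟨hzX, hz⟩)
    rcases Relation.ReflTransGen.cases_tail hd with h | ⟨_, _, h⟩
    · exact h₁.2 (h ▸ hzS)
    · exact h.2 hzS
  have hfinal : G.UndirDirReachable B x → (∃ s ∈ Z,
      Relation.ReflTransGen (D.removeInto (X ∩ Z)).dir x s) → False := by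
    rintro hr ⟨s, hs, hxs⟩
    obtain ⟨x', hx', hr', s', hs', hs'X, hx's'⟩ :=
      exists_mem_dirAvoiding_PaFin hG hD hxX hxB hr hs hxs
    refine hr'.not_transGen hG (hPa s' hs' hs'X) ?_
    obtain ⟨v, hv, hs'v⟩ : ∃ v ∈ B, G.dir s' v := by
      simpa using (Finset.mem_sdiff.1 hs').1
    obtain ⟨y, hy, hvy⟩ := hBY v hv
    exact hno.transGen_of_dirAvoiding hG hD hx' hs'X hy hx's'
      (hvy.head ⟨hD.dir_of_dir hs'v, hBX v hv⟩)
  have key : ∀ i (h : i < p.length),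
      (p[i] ∉ Z ∧ ∃ b ∈ B, Relation.ReflTransGen (UndirOriented G D) p[i] b) ∨
      (1 ≤ i ∧ G.UndirDirReachable B p[i - 1] ∧ H.dir p[i - 1] p[i]) ∨
      (G.UndirDirReachable B p[i] ∧
        ∃ z ∈ Z, z ∉ X ∧ Relation.ReflTransGen H.dir p[i] z) := by
    intro i
    induction i with
    | zero =>
      intro h
      rw [hzero]
      exact Or.inl ⟨notMem_PaFin_of_mem hb₀, b₀, hb₀, .refl⟩
    | succ i ih =>
      intro h
      rcases hedge i h with hd | hd
      · refine Or.inr (Or.inl ⟨by omega, ?_, hd⟩)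
        rcases ih (by omega) with ⟨hi, b, hb, hib⟩ | ⟨hi, hr, hd'⟩ | ⟨hr, -⟩
        · exact .of_undir hi hb (Relation.ReflTransGen.mono (fun _ _ h => h.2) _ _ hib)
        · exact hr.of_dir hG hD (hHD hd')
            (hout i (by omega) hi fun _ h' => H.dir_asymm _ _ hd h'.2)
        · exact hr
      · have hiZ := hback i h hd
        rcases ih (by omega) with ⟨-, b, hb, hib⟩ | ⟨hi, hr, hd'⟩ | ⟨hr, z, hz, hzX, hiz⟩
        · refine Or.inl ⟨hiZ, ?_⟩
          rcases hD.dir_or_undir_of_dir (hHD hd) with h' | h'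
          · rcases hG.dir_or_undirOriented hD h' hib with h' | h'
            · exact ⟨_, mem_of_dir_of_notMem_PaFin hb h' hiZ, .refl⟩
            · exact ⟨b, hb, h'⟩
          · exact ⟨b, hb, hib.head ⟨hHD hd, h'⟩⟩
        · obtain ⟨i, rfl⟩ : ∃ j, i = j + 1 := ⟨i - 1, by omega⟩
          obtain ⟨z, hz, hzX, hiz⟩ := hcollider i h hd' hd
          exact Or.inr (Or.inr ⟨hr.of_collider hG hD (hPa z hz hzX) (hHD hd') (hHD hd)
            (hHD' hiz) hiZ, z, hz, hzX, hiz.head hd⟩)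
        · exact Or.inr (Or.inr ⟨hr.of_dir_left hG hD (hPa z hz hzX) (hHD' hiz) (hHD hd) hiZ,
            z, hz, hzX, hiz.head hd⟩)
  have hx_key := key (p.length - 1) (by omega)
  rw [hend] at hx_key
  rcases hx_key with ⟨-, b, hb, hxb⟩ | ⟨-, hr, hd⟩ | ⟨hr, z, hz, -, hxz⟩
  · obtain ⟨y, hy, hby⟩ := hBY b hb
    exact (hno.dirAvoiding_of_undirOriented hD (hBX b hb) hy hby hxb).1 hxX
  · exact hfinal (hr.of_dir hG hD (hHD hd) hxB) (hS x hxX hxB hd.2)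
  · exact hfinal hr ⟨z, hz, Relation.ReflTransGen.mono
      (fun _ _ h => ⟨h.1, fun h' => h.2 (hXS h')⟩) _ _ hxz⟩

lemma Bucket.notMem_of_mem (hB : G.Bucket B (G.AnIn Y (Finset.univ \ X))) {b : V}
    (hb : b ∈ B) : b ∉ X := by
  obtain ⟨y, -, hbS, -⟩ := mem_AnIn_iff.1 (hB.2.1 hb)
  exact (Finset.mem_sdiff.1 hbS).2

lemma Bucket.exists_dirAvoiding (hD : D.InClassOf G)
    (hB : G.Bucket B (G.AnIn Y (Finset.univ \ X))) {b : V} (hb : b ∈ B) :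
    ∃ y ∈ Y, Relation.ReflTransGen (DirAvoiding D X) b y := by
  obtain ⟨y, hy, -, -, h⟩ := mem_AnIn_iff.1 (hB.2.1 hb)
  exact ⟨y, hy, Relation.ReflTransGen.mono
    (fun _ _ h => ⟨hD.dir_of_dir h.1, (Finset.mem_sdiff.1 h.2.2).2⟩) _ _ h⟩

lemma Bucket.transGen_of_mem_PaFin (hG : G.IsMPDAG)
    (hB : G.Bucket B (G.AnIn Y (Finset.univ \ X))) {z : V} (hz : z ∈ G.PaFin B) (hzX : z ∉ X)
    {b : V} (hb : b ∈ B) : Relation.TransGen G.dir z b := by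
  obtain ⟨hz', hzB⟩ := Finset.mem_sdiff.1 hz
  obtain ⟨c, hc, hzc⟩ : ∃ c ∈ B, G.dir z c := by simpa using hz'
  have hzA : z ∈ G.AnIn Y (Finset.univ \ X) := by
    obtain ⟨y, hy, hcS, hyS, h⟩ := mem_AnIn_iff.1 (hB.2.1 hc)
    have hzS : z ∈ Finset.univ \ X := by simpa using hzX
    exact mem_AnIn_iff.2 ⟨y, hy, hzS, hyS, h.head ⟨hzc, hzS, hcS⟩⟩
  have hcb := hB.2.2.1.reflTransGen hc hb
  clear hb
  induction hcb with
  | refl => exact .single hzc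
  | @tail t t' hct htt' ih =>
    refine (hG.transGen_or_undir ih htt').resolve_right fun h => hzB ?_
    exact hB.mem_of_undirReachable hzA hc
      (.head h (reflTransGen_undir_symm (hct.tail htt')))

end Parents

/-- Introduction rule for `Finset.filter` with an arbitrary decidability instance. -/
lemma mem_filter_of {α : Type*} {p : α → Prop} {_ : DecidablePred p} {s : Finset α} {a : α}
    (ha : a ∈ s) (h : p a) : a ∈ s.filter p :=
  Finset.mem_filter.2 ⟨ha, h⟩

end PDG

/-- `B_i` is d-separated from `X_{n_i}` given `Pa(B_i,G) = X_{p_i} ∪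
P_i` in the graph obtained from `D` by removing all edges into `X_{p_i} ∪ X'_{n_i}`,
for every DAG `D` in `[G]`. -/
theorem stmt12 {V : Type} [Fintype V] [DecidableEq V]
    (G : PDG V) (hG : G.IsMPDAG) (X Y : Finset V) (hXY : Disjoint X Y)
    (hno : G.NoProperPCUndirStart X Y)
    (Bs : List (Finset V)) (hk : Bs ≠ [])
    (hdec : G.IsBucketDecompList (G.AnIn Y (Finset.univ \ X)) Bs)
    (hord : G.OrderedDecomp Bs)
    (D : PDG V) (hD : D.InClassOf G)
    (i : Fin Bs.length) :
    (D.removeInto ((X ∩ G.PaFin (Bs.get i)) ∪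
        ((X \ G.PaFin (Bs.get i)).filter fun a =>
          ¬ ∃ s ∈ ((Bs.take (i : ℕ)).foldr (· ∪ ·) ∅) ∩ G.PaFin (Bs.get i),
            Relation.ReflTransGen (D.removeInto (X ∩ G.PaFin (Bs.get i))).dir a s))).DSep
      (Bs.get i) (X \ G.PaFin (Bs.get i)) (G.PaFin (Bs.get i)) := by
  have hB := hdec.1 _ (Bs.get_mem i)
  refine dSep_removeInto_PaFin hG hD hno Finset.subset_union_left ?_
    (fun b hb => hB.notMem_of_mem hb) (fun b hb => hB.exists_dirAvoiding hD hb)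
    (fun z hz hzX b hb => hB.transGen_of_mem_PaFin hG hz hzX hb)
  intro x hx hxB hxS
  by_contra! h
  refine hxS (Finset.mem_union_right _ (mem_filter_of (Finset.mem_sdiff.2 ⟨hx, hxB⟩) ?_))
  rintro ⟨s, hs, hxs⟩
  exact h s (Finset.mem_inter.1 hs).2 hxs
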